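/- For real parameters with the series convergent, ₃F₂(a₁,a₂,a₃; c₁,c₂; 1) = [Γ(c₂)Γ(c₁+c₂-a₁-a₂-a₃)/(Γ(c₂+c₁-a₁-a₂)Γ(c₂-a₃))] · ₃F₂(a₃, c₁-a₁, c₁-a₂; c₁, c₁+c₂-a₁-a₂; 1). -/

import Mathlib

/-- Pochhammer symbol (rising factorial) `(x)_k = x(x+1)⋯(x+k-1)`. -/
noncomputable def poch (x : ℝ) (k : ℕ) : ℝ := ∏ i ∈ Finset.range k, (x + i)

/-- Generalized hypergeometric function `₃F₂(a₁,a₂,a₃;c₁,c₂;x)` as a series. -/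
noncomputable def hyp3F2 (a₁ a₂ a₃ c₁ c₂ x : ℝ) : ℝ :=
  ∑' k : ℕ, poch a₁ k * poch a₂ k * poch a₃ k /
    (poch c₁ k * poch c₂ k * (Nat.factorial k)) * x ^ k

open Filter Topology Asymptotics

theorem poch_zero (x : ℝ) : poch x 0 = 1 := by simp [poch]

theorem poch_succ (x : ℝ) (k : ℕ) : poch x (k + 1) = poch x k * (x + k) := by
  simp [poch, Finset.prod_range_succ]

theorem poch_succ' (x : ℝ) (k : ℕ) : poch x (k + 1) = x * poch (x + 1) k := by
  simp only [poch, Finset.prod_range_succ', Nat.cast_zero, add_zero, mul_comm x]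
  congr 1
  refine Finset.prod_congr rfl fun i _ => ?_
  push_cast; ring

theorem poch_add (x : ℝ) (j m : ℕ) : poch x (j + m) = poch x j * poch (x + j) m := by
  simp only [poch, Finset.prod_range_add, Nat.cast_add, add_assoc]

theorem poch_one (k : ℕ) : poch 1 k = k.factorial := by
  induction k with
  | zero => simp [poch_zero]
  | succ k ih => rw [poch_succ, ih, Nat.factorial_succ]; push_cast; ring

theorem poch_ne_zero_iff {x : ℝ} : (∀ k, poch x k ≠ 0) ↔ ∀ k : ℕ, x + k ≠ 0 := by
  refine ⟨fun h k => right_ne_zero_of_mul (poch_succ x k ▸ h (k + 1)), fun h k => ?_⟩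
  exact Finset.prod_ne_zero_iff.2 fun i _ => h i

theorem poch_ne_zero_of_pos {x : ℝ} (hx : 0 < x) (k : ℕ) : poch x k ≠ 0 :=
  poch_ne_zero_iff.2 (fun k => by positivity) k

theorem poch_shift_ne_zero {x : ℝ} (h : ∀ k, poch x k ≠ 0) (j k : ℕ) : poch (x + j) k ≠ 0 :=
  right_ne_zero_of_mul (poch_add x j k ▸ h (j + k))

theorem poch_pos {x : ℝ} (hx : 0 < x) (k : ℕ) : 0 < poch x k :=
  Finset.prod_pos fun i _ => by positivity

theorem poch_nonneg {x : ℝ} (hx : 0 ≤ x) (k : ℕ) : 0 ≤ poch x k :=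
  Finset.prod_nonneg fun i _ => by positivity

theorem poch_le_poch {x y : ℝ} (hx : 0 ≤ x) (hxy : x ≤ y) (k : ℕ) : poch x k ≤ poch y k :=
  Finset.prod_le_prod (fun i _ => by positivity) fun i _ => by gcongr

theorem Gamma_ne_zero_of_poch {x : ℝ} (h : ∀ k, poch x k ≠ 0) : Real.Gamma x ≠ 0 :=
  Real.Gamma_ne_zero fun m hm => poch_ne_zero_iff.1 h m (by rw [hm]; ring)

theorem Gamma_add_natCast {x : ℝ} (h : ∀ k, poch x k ≠ 0) (j : ℕ) :
    Real.Gamma (x + j) = poch x j * Real.Gamma x := by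
  induction j with
  | zero => simp [poch_zero]
  | succ j ih =>
    rw [Nat.cast_succ, ← add_assoc, Real.Gamma_add_one (poch_ne_zero_iff.1 h j), ih, poch_succ]
    ring

theorem GammaSeq_eq_poch (x : ℝ) (n : ℕ) :
    Real.GammaSeq x n = (n : ℝ) ^ x * n.factorial / poch x (n + 1) := rfl

theorem poch_succ_eq_GammaSeq (x : ℝ) {n : ℕ} (hn : 0 < n) :
    poch x (n + 1) = (n : ℝ) ^ x * n.factorial * (Real.GammaSeq x n)⁻¹ := by
  have : (0 : ℝ) < n := by exact_mod_cast hn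
  have : (0 : ℝ) < (n : ℝ) ^ x := Real.rpow_pos_of_pos this x
  rw [GammaSeq_eq_poch, inv_div]
  field_simp

theorem GammaSeq_isBigO_one (x : ℝ) :
    Real.GammaSeq x =O[atTop] (fun _ => 1 : ℕ → ℝ) :=
  (Real.GammaSeq_tendsto_Gamma x).isBigO_one ℝ

theorem GammaSeq_inv_isBigO_one (x : ℝ) :
    (fun n => (Real.GammaSeq x n)⁻¹) =O[atTop] (fun _ => 1 : ℕ → ℝ) := by
  by_cases h : ∀ k, poch x k ≠ 0
  · exact ((Real.GammaSeq_tendsto_Gamma x).inv₀ (Gamma_ne_zero_of_poch h)).isBigO_one ℝ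
  · push Not at h
    obtain ⟨k, hk⟩ := h
    refine (isBigO_zero _ _).congr' ?_ EventuallyEq.rfl
    filter_upwards [eventually_ge_atTop k] with n hn
    obtain ⟨m, rfl⟩ := Nat.exists_eq_add_of_le hn
    rw [GammaSeq_eq_poch, add_assoc, poch_add, hk]
    simp

/-- The general term of a `₃F₂` series at argument one. -/
noncomputable def hyp3F2Term (x y z u v : ℝ) (n : ℕ) : ℝ :=
  poch x n * poch y n * poch z n / (poch u n * poch v n * n.factorial)

theorem hyp3F2_one (x y z u v : ℝ) : hyp3F2 x y z u v 1 = ∑' n, hyp3F2Term x y z u v n := by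
  simp [hyp3F2, hyp3F2Term]

theorem hyp3F2Term_isBigO (x y z u v : ℝ) :
    (fun n : ℕ => ((n : ℝ) + 1) * hyp3F2Term x y z u v (n + 1)) =O[atTop]
      fun n : ℕ => (n : ℝ) ^ (x + y + z - u - v) := by
  have key := ((((((GammaSeq_inv_isBigO_one x).mul (GammaSeq_inv_isBigO_one y)).mul
    (GammaSeq_inv_isBigO_one z)).mul (GammaSeq_isBigO_one u)).mul (GammaSeq_isBigO_one v))).mul
    (isBigO_refl (fun n : ℕ => (n : ℝ) ^ (x + y + z - u - v)) atTop)
  refine key.congr' ?_ (by simp)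
  filter_upwards [eventually_gt_atTop 0] with n hn
  have hn' : (0 : ℝ) < n := by exact_mod_cast hn
  have hp (t : ℝ) : (n : ℝ) ^ t ≠ 0 := (Real.rpow_pos_of_pos hn' t).ne'
  have hf : (n.factorial : ℝ) ≠ 0 := by positivity
  have hn1 : (n : ℝ) + 1 ≠ 0 := by positivity
  simp only [hyp3F2Term, poch_succ_eq_GammaSeq _ hn, Nat.factorial_succ, Nat.cast_mul,
    Nat.cast_succ]
  rw [Real.rpow_sub hn', Real.rpow_sub hn', Real.rpow_add hn', Real.rpow_add hn']
  generalize (Real.GammaSeq x n)⁻¹ = X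
  generalize (Real.GammaSeq y n)⁻¹ = Y
  generalize (Real.GammaSeq z n)⁻¹ = Z
  have hu : Real.GammaSeq u n = ((Real.GammaSeq u n)⁻¹)⁻¹ := (inv_inv _).symm
  have hv : Real.GammaSeq v n = ((Real.GammaSeq v n)⁻¹)⁻¹ := (inv_inv _).symm
  rw [hu, hv, inv_inv (Real.GammaSeq u n)⁻¹, inv_inv (Real.GammaSeq v n)⁻¹]
  generalize (Real.GammaSeq u n)⁻¹ = U
  generalize (Real.GammaSeq v n)⁻¹ = V
  have := hp x
  have := hp y
  have := hp z
  have := hp u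
  have := hp v
  simp only [div_eq_mul_inv, mul_inv]
  field_simp

theorem summable_hyp3F2Term {x y z u v : ℝ} (h : x + y + z < u + v) :
    Summable (hyp3F2Term x y z u v) := by
  refine (summable_nat_add_iff 1).1 ?_
  refine summable_of_isBigO_nat (g := fun n : ℕ => (n : ℝ) ^ (x + y + z - u - v - 1))
    (Real.summable_nat_rpow.2 (by linarith)) ?_
  have h1 : (fun n : ℕ => ((n : ℝ) + 1)⁻¹) =O[atTop] fun n : ℕ => (n : ℝ)⁻¹ := by
    refine IsBigO.of_bound 1 ?_
    filter_upwards [eventually_gt_atTop 0] with n hn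
    have hn' : (0 : ℝ) < n := by exact_mod_cast hn
    rw [one_mul, Real.norm_of_nonneg (by positivity), Real.norm_of_nonneg (by positivity)]
    gcongr
    linarith
  refine (h1.mul (hyp3F2Term_isBigO x y z u v)).congr' ?_ ?_
  · refine Eventually.of_forall fun n => ?_
    have : (n : ℝ) + 1 ≠ 0 := by positivity
    simp only
    field_simp
  · filter_upwards [eventually_gt_atTop 0] with n hn
    have hn' : (0 : ℝ) < n := by exact_mod_cast hn
    rw [Real.rpow_sub_one hn'.ne', div_eq_inv_mul]

theorem tendsto_natCast_mul_hyp3F2Term {x y z u v : ℝ} (h : x + y + z < u + v) :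
    Tendsto (fun n : ℕ => (n : ℝ) * hyp3F2Term x y z u v n) atTop (𝓝 0) := by
  refine (tendsto_add_atTop_iff_nat 1).1 ?_
  simp only [Nat.cast_add, Nat.cast_one]
  refine (hyp3F2Term_isBigO x y z u v).trans_tendsto ?_
  have := (tendsto_rpow_neg_atTop (y := u + v - (x + y + z)) (by linarith)).comp
    (tendsto_natCast_atTop_atTop (R := ℝ))
  refine this.congr fun n => ?_
  simp only [Function.comp]
  congr 1
  ring

/-- The general term of a `₂F₁` series at argument one. -/
noncomputable def hyp2F1Term (a b c : ℝ) (n : ℕ) : ℝ :=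
  poch a n * poch b n / (poch c n * n.factorial)

theorem hyp2F1Term_eq (a b c : ℝ) : hyp2F1Term a b c = hyp3F2Term a b 1 c 1 := by
  funext n
  have := Nat.factorial_ne_zero n
  rw [hyp2F1Term, hyp3F2Term, poch_one]
  simp only [div_eq_mul_inv, mul_inv]
  field_simp

theorem hyp2F1Term_succ (a b c : ℝ) (n : ℕ) : hyp2F1Term a b c (n + 1) =
    hyp2F1Term a b c n * ((a + n) * (b + n) / ((c + n) * (n + 1))) := by
  simp only [hyp2F1Term, poch_succ, Nat.factorial_succ, Nat.cast_mul, Nat.cast_succ,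
    div_eq_mul_inv, mul_inv]
  ring

theorem summable_hyp2F1Term {a b c : ℝ} (h : a + b < c) : Summable (hyp2F1Term a b c) := by
  rw [hyp2F1Term_eq]
  exact summable_hyp3F2Term (by linarith)

/-- Contiguous relation for the Gauss sum. -/
theorem tsum_hyp2F1Term_contiguous {a b c : ℝ} (hc : ∀ k, poch c k ≠ 0) (h : a + b < c) :
    c * (c - a - b) * ∑' n, hyp2F1Term a b c n =
      (c - a) * (c - b) * ∑' n, hyp2F1Term a b (c + 1) n := by
  have hs := summable_hyp2F1Term h
  have hs' : Summable (hyp2F1Term a b (c + 1)) := summable_hyp2F1Term (by linarith)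
  have hlim := tendsto_natCast_mul_hyp3F2Term (x := a) (y := b) (z := 1) (u := c) (v := 1)
    (by linarith)
  rw [← hyp2F1Term_eq] at hlim
  have hcn := poch_ne_zero_iff.1 hc
  have hstep (n : ℕ) : c * (c - a - b) * hyp2F1Term a b c n
      - (c - a) * (c - b) * hyp2F1Term a b (c + 1) n =
      (-c * ((n + 1 : ℕ) * hyp2F1Term a b c (n + 1))) - (-c * (n * hyp2F1Term a b c n)) := by
    have hshift : hyp2F1Term a b (c + 1) n = hyp2F1Term a b c n * (c / (c + n)) := by
      have h0 : c ≠ 0 := by simpa using hcn 0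
      have h1 : c * poch (c + 1) n = poch c n * (c + n) := by rw [← poch_succ', poch_succ]
      have h2 : poch (c + 1) n = poch c n * (c + n) / c := by
        rw [← h1]; field_simp
      have := hcn n
      have := hc n
      rw [hyp2F1Term, hyp2F1Term, h2]
      field_simp
    have := hcn n
    have : (n : ℝ) + 1 ≠ 0 := by positivity
    rw [hshift, hyp2F1Term_succ]
    push_cast
    field_simp
    ring
  have htel : HasSum (fun n => c * (c - a - b) * hyp2F1Term a b c n
      - (c - a) * (c - b) * hyp2F1Term a b (c + 1) n) 0 := by
    rw [((hs.mul_left _).sub (hs'.mul_left _)).hasSum_iff_tendsto_nat]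
    refine Tendsto.congr (fun n => ((Finset.sum_congr rfl fun i _ => hstep i).trans
      (Finset.sum_range_sub (fun m : ℕ => -c * (m * hyp2F1Term a b c m)) n)).symm) ?_
    simpa using hlim.const_mul (-c)
  have := htel.unique ((hs.hasSum.mul_left _).sub (hs'.hasSum.mul_left _))
  linarith

theorem tsum_hyp2F1Term_iterate {a b c : ℝ} (hc : ∀ k, poch c k ≠ 0) (h : a + b < c) (n : ℕ) :
    poch c n * poch (c - a - b) n * ∑' k, hyp2F1Term a b c k =
      poch (c - a) n * poch (c - b) n * ∑' k, hyp2F1Term a b (c + n) k := by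
  induction n with
  | zero => simp [poch_zero]
  | succ n ih =>
    have hn : (0 : ℝ) ≤ n := n.cast_nonneg
    have := tsum_hyp2F1Term_contiguous (a := a) (b := b) (poch_shift_ne_zero hc n) (by linarith)
    simp only [poch_succ, Nat.cast_succ, ← add_assoc]
    linear_combination (c + n) * (c - a - b + n) * ih + poch (c - a) n * poch (c - b) n * this

theorem tendsto_tsum_hyp2F1Term (a b c : ℝ) :
    Tendsto (fun n : ℕ => ∑' k, hyp2F1Term a b (c + n) k) atTop (𝓝 1) := by
  obtain ⟨N, hN⟩ := exists_nat_gt (max (-c) (a + b - c))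
  have hN1 : 0 < c + N := by linarith [le_max_left (-c) (a + b - c)]
  have hN2 : a + b < c + N := by linarith [le_max_right (-c) (a + b - c)]
  have h1 : ∑' k : ℕ, (if k = 0 then (1 : ℝ) else 0) = 1 := tsum_ite_eq 0 1
  rw [← h1]
  refine tendsto_tsum_of_dominated_convergence (summable_hyp2F1Term hN2).norm (fun k => ?_) ?_
  · rcases k with _ | k
    · simp [hyp2F1Term, poch_zero]
    · have hc : Tendsto (fun n : ℕ => c + (n : ℝ)) atTop atTop :=
        tendsto_atTop_add_const_left _ _ tendsto_natCast_atTop_atTop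
      have : Tendsto (fun n : ℕ => poch (c + n) (k + 1) * ((k + 1).factorial : ℝ)) atTop atTop := by
        refine tendsto_atTop_mono' _ ?_ hc
        filter_upwards [hc.eventually_ge_atTop 1] with n hn
        have h2 : 1 ≤ poch (c + n + 1) k := by
          have := poch_le_poch zero_le_one (show (1 : ℝ) ≤ c + n + 1 by linarith) k
          rw [poch_one] at this
          exact le_trans (by exact_mod_cast Nat.one_le_iff_ne_zero.2 k.factorial_ne_zero) this
        have h3 : (1 : ℝ) ≤ ((k + 1).factorial : ℝ) := by
          exact_mod_cast Nat.one_le_iff_ne_zero.2 (k + 1).factorial_ne_zero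
        rw [poch_succ', mul_assoc]
        exact le_mul_of_one_le_right (by linarith) (one_le_mul_of_one_le_of_one_le h2 h3)
      simpa [hyp2F1Term] using this.const_div_atTop (poch a (k + 1) * poch b (k + 1))
  · filter_upwards [eventually_ge_atTop N] with n hn k
    have hn' : (N : ℝ) ≤ n := by exact_mod_cast hn
    have h2 := poch_le_poch hN1.le (show c + N ≤ c + n by linarith) k
    have h3 := poch_pos hN1 k
    rw [hyp2F1Term, hyp2F1Term, norm_div, norm_div, norm_mul (poch (c + n) k),
      norm_mul (poch (c + N) k), Real.norm_of_nonneg h3.le, Real.norm_of_nonneg (h3.le.trans h2)]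
    have : (0 : ℝ) < ‖(k.factorial : ℝ)‖ :=
      norm_pos_iff.2 (Nat.cast_ne_zero.2 k.factorial_ne_zero)
    gcongr

/-- **Gauss's summation theorem**. -/
theorem tsum_hyp2F1Term {a b c : ℝ} (hc : ∀ k, poch c k ≠ 0) (hca : ∀ k, poch (c - a) k ≠ 0)
    (hcb : ∀ k, poch (c - b) k ≠ 0) (h : a + b < c) :
    ∑' k, hyp2F1Term a b c k = Real.Gamma c * Real.Gamma (c - a - b) /
      (Real.Gamma (c - a) * Real.Gamma (c - b)) := by
  have hlim := (((Real.GammaSeq_tendsto_Gamma c).mul (Real.GammaSeq_tendsto_Gamma (c - a - b))).div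
    ((Real.GammaSeq_tendsto_Gamma (c - a)).mul (Real.GammaSeq_tendsto_Gamma (c - b)))
    (mul_ne_zero (Gamma_ne_zero_of_poch hca) (Gamma_ne_zero_of_poch hcb))).mul
    ((tendsto_add_atTop_iff_nat 1).2 (tendsto_tsum_hyp2F1Term a b c))
  rw [mul_one] at hlim
  refine tendsto_nhds_unique (tendsto_const_nhds.congr' ?_) hlim
  filter_upwards [eventually_gt_atTop 0] with n hn
  have hn' : (0 : ℝ) < n := by exact_mod_cast hn
  have hit := tsum_hyp2F1Term_iterate hc h (n + 1)
  have h1 := hc (n + 1)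
  have h2 := hca (n + 1)
  have h3 := hcb (n + 1)
  have h4 := poch_ne_zero_of_pos (show 0 < c - a - b by linarith) (n + 1)
  have hpow : (n : ℝ) ^ c * (n : ℝ) ^ (c - a - b) = (n : ℝ) ^ (c - a) * (n : ℝ) ^ (c - b) := by
    rw [← Real.rpow_add hn', ← Real.rpow_add hn']
    ring_nf
  have hp1 := (Real.rpow_pos_of_pos hn' (c - a)).ne'
  have hp2 := (Real.rpow_pos_of_pos hn' (c - b)).ne'
  have hf : (n.factorial : ℝ) ≠ 0 := by positivity
  simp only [Pi.div_apply, GammaSeq_eq_poch]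
  field_simp
  rw [hpow]
  linear_combination ((n : ℝ) ^ (c - a) * (n : ℝ) ^ (c - b)) * hit

/-- Coefficientwise form of Euler's transformation
`₂F₁(a, b; c; x) = (1 - x) ^ (c - a - b) ₂F₁(c - a, c - b; c; x)`. -/
theorem hyp2F1Term_eq_sum {c : ℝ} (hc : ∀ k, poch c k ≠ 0) (a b : ℝ) (k : ℕ) :
    hyp2F1Term a b c k = ∑ j ∈ Finset.range (k + 1),
      hyp2F1Term (c - a) (c - b) c j * (poch (a + b - c) (k - j) / (k - j).factorial) := by
  have hcn := poch_ne_zero_iff.1 hc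
  set u := hyp2F1Term (c - a) (c - b) c with hu
  set v : ℕ → ℝ := fun m => poch (a + b - c) m / m.factorial with hv
  change _ = ∑ j ∈ Finset.range (k + 1), u j * v (k - j)
  have hv_succ (m : ℕ) : v (m + 1) = v m * ((a + b - c + m) / (m + 1)) := by
    simp only [hv, poch_succ, Nat.factorial_succ, Nat.cast_mul, Nat.cast_succ, div_eq_mul_inv,
      mul_inv]
    ring
  have hv_zero : v 0 = 1 := by simp [hv, poch_zero]
  induction k with
  | zero => simp [hu, hv_zero, hyp2F1Term, poch_zero]
  | succ k ih =>
    have hcert (j : ℕ) (hj : j ∈ Finset.range (k + 1)) :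
        (c + k) * (k + 1) * (u j * v (k + 1 - j)) - (a + k) * (b + k) * (u j * v (k - j)) =
        (-((j + 1 : ℕ) * (c + (j + 1 : ℕ) - 1) * (u (j + 1) * v (k + 1 - (j + 1)))))
          - (-(j * (c + j - 1) * (u j * v (k + 1 - j)))) := by
      obtain ⟨m, rfl⟩ := Nat.exists_eq_add_of_le (Nat.lt_succ_iff.1 (Finset.mem_range.1 hj))
      have h1 : j + m + 1 - j = m + 1 := by lia
      have h2 : j + m + 1 - (j + 1) = m := by lia
      have h3 : j + m - j = m := by lia
      have := hcn j
      have : (j : ℝ) + 1 ≠ 0 := by positivity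
      have : (m : ℝ) + 1 ≠ 0 := by positivity
      rw [h1, h2, h3, hv_succ, hu, hyp2F1Term_succ]
      push_cast
      field_simp
      ring
    have hsum := (Finset.sum_congr rfl hcert).trans (Finset.sum_range_sub
      (fun j : ℕ => -(j * (c + j - 1) * (u j * v (k + 1 - j)))) (k + 1))
    rw [Finset.sum_sub_distrib, ← Finset.mul_sum, ← Finset.mul_sum, ← ih] at hsum
    simp only [Nat.sub_self, hv_zero, Nat.cast_zero, zero_mul, neg_zero, sub_zero] at hsum
    push_cast at hsum
    have := hcn k
    have h1 : (k : ℝ) + 1 ≠ 0 := by positivity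
    rw [Finset.sum_range_succ _ (k + 1), Nat.sub_self, hv_zero, hyp2F1Term_succ]
    field_simp
    linear_combination -hsum

theorem hyp3F2_transform_of_nonneg {a₁ a₂ a₃ c₁ c₂ : ℝ} (he : 0 ≤ a₁ + a₂ - c₁)
    (h₁ : 0 < c₁ + c₂ - a₁ - a₂ - a₃) (h₂ : 0 < c₂ - a₃)
    (hc₁ : ∀ k : ℕ, poch c₁ k ≠ 0) (hc₂ : ∀ k : ℕ, poch c₂ k ≠ 0)
    (hc₃ : ∀ k : ℕ, poch (c₁ + c₂ - a₁ - a₂) k ≠ 0) :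
    hyp3F2 a₁ a₂ a₃ c₁ c₂ 1
      = (Real.Gamma c₂ * Real.Gamma (c₁ + c₂ - a₁ - a₂ - a₃) /
          (Real.Gamma (c₁ + c₂ - a₁ - a₂) * Real.Gamma (c₂ - a₃))) *
        hyp3F2 a₃ (c₁ - a₁) (c₁ - a₂) c₁ (c₁ + c₂ - a₁ - a₂) 1 := by
  set e := a₁ + a₂ - c₁ with hedef
  set c₃ := c₁ + c₂ - a₁ - a₂ with hc₃def
  set K := Real.Gamma c₂ * Real.Gamma (c₃ - a₃) / (Real.Gamma c₃ * Real.Gamma (c₂ - a₃)) with hK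
  set u := hyp2F1Term (c₁ - a₁) (c₁ - a₂) c₁ with hu
  set v : ℕ → ℝ := fun m => poch e m / m.factorial with hv
  set w : ℕ → ℝ := fun k => poch a₃ k / poch c₂ k with hw
  set T : ℕ × ℕ → ℝ := fun p => u p.1 * (w (p.1 + p.2) * v p.2) with hT
  have hinner (j m : ℕ) : w (j + m) * v m = w j * hyp2F1Term e (a₃ + j) (c₂ + j) m := by
    simp only [hw, hv, hyp2F1Term, poch_add, div_eq_mul_inv, mul_inv]
    ring
  have hinner_summable (j : ℕ) : Summable (hyp2F1Term e (a₃ + j) (c₂ + j)) :=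
    summable_hyp2F1Term (by linarith)
  have hgauss (j : ℕ) : u j * (w j * ∑' m, hyp2F1Term e (a₃ + j) (c₂ + j) m) =
      K * hyp3F2Term a₃ (c₁ - a₁) (c₁ - a₂) c₁ c₃ j := by
    have e1 : c₂ + (j : ℝ) - e = c₃ + j := by rw [hedef, hc₃def]; ring
    have e2 : c₂ + (j : ℝ) - (a₃ + j) = c₂ - a₃ := by ring
    have e3 : c₃ + (j : ℝ) - (a₃ + j) = c₃ - a₃ := by ring
    rw [tsum_hyp2F1Term (poch_shift_ne_zero hc₂ j) (by rw [e1]; exact poch_shift_ne_zero hc₃ j)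
      (by rw [e2]; exact poch_ne_zero_of_pos h₂) (by linarith), e1, e2, e3,
      Gamma_add_natCast hc₂, Gamma_add_natCast hc₃]
    have := hc₁ j
    have := hc₂ j
    have := hc₃ j
    have := Gamma_ne_zero_of_poch hc₃
    have := Gamma_ne_zero_of_poch (poch_ne_zero_of_pos h₂)
    simp only [hw, hu, hK, hyp2F1Term, hyp3F2Term]
    field_simp
  have hsum₂ : Summable (hyp3F2Term a₃ (c₁ - a₁) (c₁ - a₂) c₁ c₃) :=
    summable_hyp3F2Term (by linarith)
  have hT_row (j : ℕ) : (fun m => T (j, m)) =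
      fun m => u j * (w j * hyp2F1Term e (a₃ + j) (c₂ + j) m) := by
    funext m
    simp only [hT, hinner]
  have hTsum : Summable T := by
    rw [← summable_norm_iff, summable_prod_of_nonneg fun _ => norm_nonneg _]
    refine ⟨fun j => ?_, ?_⟩
    · have := (((hinner_summable j).mul_left (w j)).mul_left (u j)).norm
      exact this.congr fun m => by rw [congrFun (hT_row j) m]
    · obtain ⟨N, hN⟩ := exists_nat_gt (max (-a₃) (-c₂))
      refine (summable_nat_add_iff N).1 (((summable_nat_add_iff N).2
        (hsum₂.mul_left K).norm).congr fun i => ?_)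
      have hiN : (N : ℝ) ≤ (i + N : ℕ) := by exact_mod_cast Nat.le_add_left N i
      have ha : 0 ≤ a₃ + (i + N : ℕ) := by linarith [le_max_left (-a₃) (-c₂)]
      have hc : 0 ≤ c₂ + (i + N : ℕ) := by linarith [le_max_right (-a₃) (-c₂)]
      have hnn (m : ℕ) : 0 ≤ hyp2F1Term e (a₃ + (i + N : ℕ)) (c₂ + (i + N : ℕ)) m := by
        have := poch_nonneg he m
        have := poch_nonneg ha m
        have := poch_nonneg hc m
        unfold hyp2F1Term
        positivity
      rw [← hgauss, norm_mul, norm_mul, Real.norm_of_nonneg (tsum_nonneg hnn), ← tsum_mul_left,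
        ← tsum_mul_left]
      refine tsum_congr fun m => ?_
      rw [congrFun (hT_row (i + N)) m, norm_mul, norm_mul, Real.norm_of_nonneg (hnn m)]
  have hdiag (k : ℕ) : hyp3F2Term a₁ a₂ a₃ c₁ c₂ k =
      ∑ p ∈ Finset.HasAntidiagonal.antidiagonal k, T p := by
    have hprod : hyp3F2Term a₁ a₂ a₃ c₁ c₂ k = w k * hyp2F1Term a₁ a₂ c₁ k := by
      simp only [hw, hyp3F2Term, hyp2F1Term, div_eq_mul_inv, mul_inv]
      ring
    rw [hprod, hyp2F1Term_eq_sum hc₁, Finset.mul_sum,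
      Finset.Nat.sum_antidiagonal_eq_sum_range_succ_mk]
    refine Finset.sum_congr rfl fun j hj => ?_
    simp only [hT, hv, hu, hedef,
      Nat.add_sub_cancel' (Nat.lt_succ_iff.1 (Finset.mem_range.1 hj))]
    ring
  rw [hyp3F2_one, hyp3F2_one, ← tsum_mul_left]
  simp_rw [hdiag, ← hgauss]
  have hsig := (Finset.HasAntidiagonal.sigmaAntidiagonalEquivProd (A := ℕ)).summable_iff.2 hTsum
  calc ∑' k, ∑ p ∈ Finset.HasAntidiagonal.antidiagonal k, T p = ∑' p, T p := by
        rw [← (Finset.HasAntidiagonal.sigmaAntidiagonalEquivProd (A := ℕ)).tsum_eq T]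
        refine Eq.trans ?_ (hsig.tsum_sigma' fun n => (hasSum_fintype _).summable).symm
        refine tsum_congr fun k => ?_
        rw [tsum_fintype, ← Finset.sum_coe_sort]
        rfl
    _ = ∑' j, ∑' m, T (j, m) := hTsum.tsum_prod
    _ = _ := by
        refine tsum_congr fun j => ?_
        rw [hT_row, tsum_mul_left, tsum_mul_left]

theorem hyp3F2_comm (x y z u v t : ℝ) : hyp3F2 x y z u v t = hyp3F2 z x y u v t := by
  unfold hyp3F2
  refine tsum_congr fun k => ?_
  ring

/-- the Thomae-type transformation
`₃F₂(a₁,a₂,a₃;c₁,c₂;1) = [Γ(c₂)Γ(c₁+c₂-a₁-a₂-a₃)/(Γ(c₂+c₁-a₁-a₂)Γ(c₂-a₃))]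
  · ₃F₂(a₃, c₁-a₁, c₁-a₂; c₁, c₁+c₂-a₁-a₂; 1)`. -/
theorem hyp3F2_transform (a₁ a₂ a₃ c₁ c₂ : ℝ)
    (h₁ : 0 < c₁ + c₂ - a₁ - a₂ - a₃) (h₂ : 0 < c₂ - a₃)
    (hc₁ : ∀ k : ℕ, poch c₁ k ≠ 0) (hc₂ : ∀ k : ℕ, poch c₂ k ≠ 0)
    (hc₃ : ∀ k : ℕ, poch (c₁ + c₂ - a₁ - a₂) k ≠ 0) :
    hyp3F2 a₁ a₂ a₃ c₁ c₂ 1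
      = (Real.Gamma c₂ * Real.Gamma (c₁ + c₂ - a₁ - a₂ - a₃) /
          (Real.Gamma (c₂ + c₁ - a₁ - a₂) * Real.Gamma (c₂ - a₃))) *
        hyp3F2 a₃ (c₁ - a₁) (c₁ - a₂) c₁ (c₁ + c₂ - a₁ - a₂) 1 := by
  have hg : c₂ + c₁ - a₁ - a₂ = c₁ + c₂ - a₁ - a₂ := by ring
  rw [hg]
  rcases le_total 0 (a₁ + a₂ - c₁) with he | he
  · exact hyp3F2_transform_of_nonneg he h₁ h₂ hc₁ hc₂ hc₃
  · have e1 : c₁ + (c₁ + c₂ - a₁ - a₂) - (c₁ - a₁) - (c₁ - a₂) = c₂ := by ring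
    have key := hyp3F2_transform_of_nonneg (a₁ := c₁ - a₁) (a₂ := c₁ - a₂) (a₃ := a₃) (c₁ := c₁)
      (c₂ := c₁ + c₂ - a₁ - a₂) (by linarith) (by linarith) h₁ hc₁ hc₃ (by rwa [e1])
    rw [e1, sub_sub_cancel, sub_sub_cancel] at key
    rw [← hyp3F2_comm (c₁ - a₁), key, hyp3F2_comm a₁]
    have := Gamma_ne_zero_of_poch hc₂
    have := Gamma_ne_zero_of_poch hc₃
    have := Gamma_ne_zero_of_poch (poch_ne_zero_of_pos h₁)
    have := Gamma_ne_zero_of_poch (poch_ne_zero_of_pos h₂)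
    field_simp
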